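/- ∫₁^∞ log(log(x)) / (1 + x²) dx = (π/2) · log( √(2π) · Γ(3/4) / Γ(1/4) ). -/

import Mathlib

open MeasureTheory Real

open Filter Topology in
lemma int_base : IntegrableOn (fun v : ℝ => Real.log v * (1 + v ^ 2)⁻¹) (Set.Ioi 0) := by
  have hm : Measurable (fun v : ℝ => Real.log v * (1 + v ^ 2)⁻¹) := by fun_prop
  rw [← Set.Ioc_union_Ioi_eq_Ioi (zero_le_one (α := ℝ))]
  refine IntegrableOn.union ?_ ?_
  · have h : IntegrableOn Real.log (Set.Ioc 0 1) :=
      (intervalIntegrable_iff_integrableOn_Ioc_of_le zero_le_one).1 intervalIntegral.intervalIntegrable_log'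
    refine Integrable.mono h hm.aestronglyMeasurable (Eventually.of_forall fun v => ?_)
    rw [norm_mul]
    refine mul_le_of_le_one_right (norm_nonneg _) ?_
    rw [Real.norm_of_nonneg (by positivity)]
    exact inv_le_one_of_one_le₀ (by nlinarith [sq_nonneg v])
  · have h : IntegrableOn (fun t : ℝ => 2 * t ^ (-(3/2) : ℝ)) (Set.Ioi 1) :=
      (integrableOn_Ioi_rpow_of_lt (by norm_num) one_pos).const_mul 2
    refine Integrable.mono' h hm.aestronglyMeasurable ?_
    refine ae_restrict_of_forall_mem measurableSet_Ioi fun v hv => ?_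
    have hv1 : (1:ℝ) < v := hv
    have hv0 : 0 < v := by linarith
    have h1 : Real.log v ≤ 2 * v ^ (1/2 : ℝ) := by
      have := Real.log_le_rpow_div hv0.le (ε := 1/2) (by norm_num)
      linarith
    have h0 : 0 ≤ Real.log v := Real.log_nonneg hv1.le
    rw [Real.norm_of_nonneg (by positivity)]
    have h2 : (1 + v ^ 2)⁻¹ ≤ v ^ (-2 : ℝ) := by
      rw [Real.rpow_neg hv0.le, Real.rpow_two]
      exact inv_anti₀ (by positivity) (by linarith)
    calc Real.log v * (1 + v ^ 2)⁻¹ ≤ (2 * v ^ (1/2 : ℝ)) * v ^ (-2 : ℝ) := by gcongr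
      _ = 2 * v ^ (-(3/2) : ℝ) := by
        rw [mul_assoc, ← Real.rpow_add hv0]; norm_num

lemma integral_base : ∫ v in Set.Ioi (0:ℝ), Real.log v * (1 + v ^ 2)⁻¹ = 0 := by
  have h := integral_comp_rpow_Ioi (fun v : ℝ => Real.log v * (1 + v ^ 2)⁻¹) (p := -1) (by norm_num)
  have h2 : ∫ x in Set.Ioi (0:ℝ), (|(-1:ℝ)| * x ^ ((-1:ℝ) - 1)) • (Real.log (x ^ (-1:ℝ)) * (1 + (x ^ (-1:ℝ)) ^ 2)⁻¹)
      = ∫ x in Set.Ioi (0:ℝ), -(Real.log x * (1 + x ^ 2)⁻¹) := by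
    refine setIntegral_congr_fun measurableSet_Ioi fun x hx => ?_
    have hx0 : (0:ℝ) < x := hx
    have e : x ^ ((-1:ℝ) - 1) = (x^2)⁻¹ := by
      rw [show ((-1:ℝ) - 1) = -2 by norm_num, Real.rpow_neg hx0.le, Real.rpow_two]
    simp only [e, Real.rpow_neg_one, Real.log_inv, smul_eq_mul, abs_neg, abs_one]
    field_simp
    ring
  rw [h2, integral_neg] at h
  linarith

lemma scale_eq {a c v : ℝ} (ha : 0 < a) (hc : 0 < c) (hv : 0 < v) :
    Real.log (a * (c * v)) * (2 * c / (c ^ 2 + (c * v) ^ 2)) =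
      2 / c * (Real.log v * (1 + v ^ 2)⁻¹) + 2 / c * Real.log (a * c) * (1 + v ^ 2)⁻¹ := by
  rw [← mul_assoc, Real.log_mul (by positivity) hv.ne']
  field_simp
  ring

lemma int_log {a c : ℝ} (ha : 0 < a) (hc : 0 < c) :
    IntegrableOn (fun w : ℝ => Real.log (a * w) * (2 * c / (c ^ 2 + w ^ 2))) (Set.Ioi 0) := by
  have h := (integrableOn_Ioi_comp_mul_left_iff
    (fun w : ℝ => Real.log (a * w) * (2 * c / (c ^ 2 + w ^ 2))) 0 hc).1
  rw [mul_zero] at h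
  apply h
  have h3 : IntegrableOn (fun v : ℝ => 2 / c * (Real.log v * (1 + v ^ 2)⁻¹) +
      2 / c * Real.log (a * c) * (1 + v ^ 2)⁻¹) (Set.Ioi 0) :=
    (int_base.const_mul _).add (integrable_inv_one_add_sq.integrableOn.const_mul _)
  exact h3.congr_fun (fun v hv => (scale_eq ha hc hv).symm) measurableSet_Ioi

lemma integral_logT {a c : ℝ} (ha : 0 < a) (hc : 0 < c) :
    ∫ w in Set.Ioi (0:ℝ), Real.log (a * w) * (2 * c / (c ^ 2 + w ^ 2)) = π * Real.log (a * c) := by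
  have h := integral_comp_mul_left_Ioi
    (fun w : ℝ => Real.log (a * w) * (2 * c / (c ^ 2 + w ^ 2))) 0 hc
  rw [mul_zero, setIntegral_congr_fun measurableSet_Ioi (fun v hv => scale_eq ha hc hv),
    integral_add (int_base.const_mul _) (integrable_inv_one_add_sq.integrableOn.const_mul _),
    integral_const_mul, integral_const_mul, integral_base, integral_Ioi_inv_one_add_sq] at h
  simp only [Real.arctan_zero, smul_eq_mul] at h
  generalize (∫ x in Set.Ioi (0:ℝ), Real.log (a * x) * (2 * c / (c ^ 2 + x ^ 2))) = J at h ⊢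
  field_simp at h
  rw [mul_comm a c]
  linarith

noncomputable def fT (c w : ℝ) : ℝ := 2 * c / (c ^ 2 + w ^ 2)

noncomputable def TT (N : ℕ) (w : ℝ) : ℝ :=
  ∑ k ∈ Finset.range N, (fT (k + 1/4) w - fT (k + 3/4) w) + fT (N + 1/4) w / 2

lemma second_diff {c : ℝ} (hc : 3/4 ≤ c) (w : ℝ) :
    |fT (c - 1/2) w / 2 - fT c w + fT (c + 1/2) w / 2| ≤
      3/4 * (1 / ((c - 1/2)^2 + w^2) - 1 / ((c + 1/2)^2 + w^2)) := by
  have hA : 0 < (c - 1/2)^2 + w^2 := by nlinarith [sq_nonneg w]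
  have hB : 0 < (c + 1/2)^2 + w^2 := by nlinarith [sq_nonneg w]
  have hM : 0 < c^2 + w^2 := by nlinarith [sq_nonneg w]
  have e1 : fT (c - 1/2) w / 2 - fT c w + fT (c + 1/2) w / 2 =
      (1/2) * c * (c^2 - 3*w^2 - 1/4) / ((c^2+w^2) * (((c - 1/2)^2 + w^2) * ((c + 1/2)^2 + w^2))) := by
    unfold fT
    rw [div_div, div_div, div_sub_div _ _ (by positivity) (by positivity), div_add_div _ _ (by positivity) (by positivity),
      div_eq_div_iff (by positivity) (by positivity)]
    ring
  have e2 : 3/4 * (1 / ((c - 1/2)^2 + w^2) - 1 / ((c + 1/2)^2 + w^2)) =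
      (1/2) * c * (3 * (c^2+w^2)) / ((c^2+w^2) * (((c - 1/2)^2 + w^2) * ((c + 1/2)^2 + w^2))) := by
    rw [div_sub_div _ _ (by positivity) (by positivity), ← mul_div_assoc,
      div_eq_div_iff (by positivity) (by positivity)]
    ring
  rw [e1, e2, abs_div, abs_mul, abs_of_pos (show 0 < (c^2+w^2) * (((c - 1/2)^2 + w^2) * ((c + 1/2)^2 + w^2)) by positivity),
    abs_of_pos (show 0 < (1/2) * c by linarith)]
  have : |c^2 - 3*w^2 - 1/4| ≤ 3 * (c^2+w^2) := by
    rw [abs_le]; constructor <;> nlinarith [sq_nonneg w]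
  gcongr

lemma TT_bound (N : ℕ) (w : ℝ) (hw : 0 < w) : |TT N w| ≤ 1 / ((1/4)^2 + w^2) := by
  have key : |TT N w| ≤ 1/4 * (1 / ((1/4)^2 + w^2)) +
      3/4 * (1 / ((1/4)^2 + w^2) - 1 / (((N:ℝ) + 1/4)^2 + w^2)) := by
    induction N with
    | zero =>
      simp only [TT, fT, Finset.range_zero, Finset.sum_empty, Nat.cast_zero, zero_add, sub_self, mul_zero, add_zero]
      rw [abs_of_pos (by positivity)]
      apply le_of_eq; ring
    | succ n ih =>
      have h := second_diff (c := n + 3/4) (by have : (0:ℝ) ≤ n := n.cast_nonneg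
                                               linarith) w
      rw [show (n:ℝ) + 3/4 - 1/2 = n + 1/4 by ring, show (n:ℝ) + 3/4 + 1/2 = (n + 1 : ℕ) + 1/4 by push_cast; ring] at h
      have e : TT (n+1) w = TT n w + (fT (n + 1/4) w / 2 - fT (n + 3/4) w + fT ((n+1:ℕ) + 1/4) w / 2) := by
        simp only [TT, Finset.sum_range_succ]; ring
      rw [e]
      refine (abs_add_le _ _).trans ?_
      linarith
  refine key.trans ?_
  have : 0 ≤ 1 / (((N:ℝ) + 1/4)^2 + w^2) := by positivity
  linarith

open Filter Topology in
lemma fT_tendsto (w : ℝ) : Tendsto (fun N : ℕ => fT (N + 1/4) w) atTop (𝓝 0) := by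
  have h1 : Tendsto (fun N : ℕ => 2 / ((N:ℝ) + 1/4)) atTop (𝓝 0) :=
    Tendsto.const_div_atTop (tendsto_atTop_add_const_right _ _ tendsto_natCast_atTop_atTop) _
  refine squeeze_zero (fun N => by unfold fT; positivity) (fun N => ?_) h1
  unfold fT
  rw [div_le_div_iff₀ (by positivity) (by positivity)]
  nlinarith [sq_nonneg w]

open Filter Topology in
lemma gamma_lim : Tendsto (fun n : ℕ => ∑ k ∈ Finset.range (n+1), (π * Real.log (2 * π * (k + 1/4)) - π * Real.log (2 * π * (k + 3/4)))
    + π * Real.log (2 * π * ((n + 1 : ℕ) + 1/4)) / 2) atTop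
    (𝓝 (π * Real.log (Real.sqrt (2 * π) * Real.Gamma (3/4) / Real.Gamma (1/4)))) := by
  have h3 := Real.GammaSeq_tendsto_Gamma (3/4)
  have h1 := Real.GammaSeq_tendsto_Gamma (1/4)
  have hG1 : 0 < Real.Gamma (1/4) := Real.Gamma_pos_of_pos (by norm_num)
  have hG3 : 0 < Real.Gamma (3/4) := Real.Gamma_pos_of_pos (by norm_num)
  have hq := h3.div h1 hG1.ne'
  have hr : Tendsto (fun n : ℕ => √(2 * π * (1 + 5/4 / (n:ℝ)))) atTop (𝓝 (√(2 * π))) := by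
    have : Tendsto (fun n : ℕ => √(2 * π * (1 + 5/4 / (n:ℝ)))) atTop (𝓝 (√(2 * π * (1 + 0)))) :=
      (Real.continuous_sqrt.tendsto _).comp
        (((tendsto_const_div_atTop_nhds_zero_nat (5/4 : ℝ)).const_add 1).const_mul _)
    simpa using this
  have hl := (((hr.mul hq).log (by positivity)).const_mul π)
  rw [mul_div_assoc]
  refine hl.congr' ?_
  filter_upwards [eventually_gt_atTop 0] with n hn
  have hn' : (0:ℝ) < n := by exact_mod_cast hn
  have hp1 : 0 < ∏ j ∈ Finset.range (n+1), ((1/4:ℝ) + j) := Finset.prod_pos fun j _ => by positivity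
  have hp3 : 0 < ∏ j ∈ Finset.range (n+1), ((3/4:ℝ) + j) := Finset.prod_pos fun j _ => by positivity
  have e : Real.GammaSeq (3/4) n / Real.GammaSeq (1/4) n =
      √n * ((∏ j ∈ Finset.range (n+1), ((1/4:ℝ) + j)) / ∏ j ∈ Finset.range (n+1), ((3/4:ℝ) + j)) := by
    have : (n:ℝ) ^ (3/4:ℝ) = √n * (n:ℝ) ^ (1/4:ℝ) := by
      rw [Real.sqrt_eq_rpow, ← Real.rpow_add hn']; norm_num
    unfold Real.GammaSeq
    rw [this]
    have : (n.factorial : ℝ) ≠ 0 := by positivity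
    field_simp
  simp only [Pi.div_apply]
  rw [e, ← mul_assoc, ← Real.sqrt_mul (by positivity), 
    show 2 * π * (1 + 5/4 / (n:ℝ)) * n = 2 * π * ((n + 1 : ℕ) + 1/4) by push_cast; field_simp; ring,
    Real.log_mul (by positivity) (by positivity), Real.log_sqrt (by positivity),
    Real.log_div hp1.ne' hp3.ne', Real.log_prod (fun j _ => by positivity), Real.log_prod (fun j _ => by positivity),
    ← Finset.sum_sub_distrib, mul_add, Finset.mul_sum, add_comm, mul_div_assoc]
  congr 1
  refine Finset.sum_congr rfl fun k _ => ?_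
  rw [Real.log_mul (x := 2 * π) (y := k + 1/4) (by positivity) (by positivity), Real.log_mul (x := 2 * π) (y := k + 3/4) (by positivity) (by positivity), add_comm (1/4:ℝ), add_comm (3/4:ℝ)]
  ring

lemma fT_complex (c w : ℝ) (hw : 0 < w) :
    1 / ((c:ℂ) + w * Complex.I) + 1 / ((c:ℂ) - w * Complex.I) = ((fT c w : ℝ) : ℂ) := by
  have h1 : (c:ℂ) + w * Complex.I ≠ 0 := by
    intro h
    have := congrArg Complex.im h
    simp at this
    exact hw.ne' this
  have h2 : (c:ℂ) - w * Complex.I ≠ 0 := by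
    intro h
    have := congrArg Complex.im h
    simp at this
    exact hw.ne' this
  have h3 : ((c:ℂ)^2 + w^2) = ((c:ℂ) + w * Complex.I) * ((c:ℂ) - w * Complex.I) := by
    ring_nf
    rw [Complex.I_sq]
    ring
  unfold fT
  push_cast
  rw [h3]
  field_simp
  ring

lemma mem_compl (c w : ℝ) (hw : w ≠ 0) : (c:ℂ) + w * Complex.I ∈ Complex.integerComplement := by
  rw [Complex.mem_integerComplement_iff]
  rintro ⟨n, hn⟩
  have := congrArg Complex.im hn
  simp at this
  exact hw this.symm

lemma cot_add (w : ℝ) (hw : 0 < w) :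
    Complex.cot (π * (((1/4 : ℝ):ℂ) + w * Complex.I)) + Complex.cot (π * (((1/4 : ℝ):ℂ) + (-w : ℝ) * Complex.I))
      = ((2 / Real.cosh (2 * π * w) : ℝ) : ℂ) := by
  have h1 := sin_pi_mul_ne_zero (mem_compl (1/4) w hw.ne')
  have h2 := sin_pi_mul_ne_zero (mem_compl (1/4) (-w) (neg_ne_zero.2 hw.ne'))
  set A := (π:ℂ) * (((1/4 : ℝ):ℂ) + w * Complex.I) with hA
  set B := (π:ℂ) * (((1/4 : ℝ):ℂ) + (-w : ℝ) * Complex.I) with hB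
  have hs : A + B = π / 2 := by rw [hA, hB]; push_cast; ring
  have hd : A - B = (2 * π * w : ℝ) * Complex.I := by rw [hA, hB]; push_cast; ring
  have e1 : Complex.sin A * Complex.cos B + Complex.cos A * Complex.sin B = 1 := by
    rw [← Complex.sin_add, hs, Complex.sin_pi_div_two]
  have e2 : Complex.cos A * Complex.cos B - Complex.sin A * Complex.sin B = 0 := by
    rw [← Complex.cos_add, hs, Complex.cos_pi_div_two]
  have e3 : Complex.cos A * Complex.cos B + Complex.sin A * Complex.sin B = Complex.cosh (2 * π * w : ℝ) := by
    rw [← Complex.cos_sub, hd, Complex.cos_mul_I]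
  have e4 : Complex.sin A * Complex.sin B = Complex.cosh (2 * π * w : ℝ) / 2 := by
    linear_combination (e3 - e2) / 2
  rw [Complex.cot, Complex.cot, div_add_div _ _ h1 h2,
    show Complex.cos A * Complex.sin B + Complex.sin A * Complex.cos B = 1 by linear_combination e1, e4]
  push_cast
  rw [one_div_div]

open Filter Topology in
lemma TT_tendsto (w : ℝ) (hw : 0 < w) : Tendsto (fun N : ℕ => TT N w) atTop (𝓝 (2 * π / Real.cosh (2 * π * w))) := by
  have hA := tendsto_logDeriv_euler_cot_sub (mem_compl (1/4) w hw.ne')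
  have hB := tendsto_logDeriv_euler_cot_sub (mem_compl (1/4) (-w) (neg_ne_zero.2 hw.ne'))
  have hS := (hA.add hB).add_const (((fT (1/4) w : ℝ) : ℂ))
  have key : ∀ N : ℕ, ∑ j ∈ Finset.range N, cotTerm (((1/4 : ℝ):ℂ) + w * Complex.I) j +
      ∑ j ∈ Finset.range N, cotTerm (((1/4 : ℝ):ℂ) + (-w : ℝ) * Complex.I) j + ((fT (1/4) w : ℝ) : ℂ) =
      ((TT N w + fT (N + 1/4) w / 2 : ℝ) : ℂ) := by
    intro N
    induction N with
    | zero => simp [TT]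
    | succ n ih =>
      have i1 := fT_complex (-(n + 3/4)) w hw
      have i2 := fT_complex ((n+1:ℕ) + 1/4) w hw
      have i3 : fT (-(n + 3/4)) w = - fT (n + 3/4) w := by
        unfold fT; rw [neg_sq]; ring
      rw [i3] at i1
      have e : (TT (n+1) w + fT ((n+1:ℕ) + 1/4) w / 2 : ℝ) = (TT n w + fT (n + 1/4) w / 2)
          + (- fT (n + 3/4) w + fT ((n+1:ℕ) + 1/4) w) := by
        simp only [TT, Finset.sum_range_succ]; ring
      rw [e, Complex.ofReal_add, ← ih, Complex.ofReal_add, ← i1, ← i2, Finset.sum_range_succ, Finset.sum_range_succ]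
      simp only [cotTerm]
      push_cast
      ring_nf
  simp_rw [key] at hS
  have hval : (π:ℂ) * Complex.cot (π * (((1/4 : ℝ):ℂ) + w * Complex.I)) - 1 / (((1/4 : ℝ):ℂ) + w * Complex.I) +
      (π * Complex.cot (π * (((1/4 : ℝ):ℂ) + (-w : ℝ) * Complex.I)) - 1 / (((1/4 : ℝ):ℂ) + (-w : ℝ) * Complex.I))
      + ((fT (1/4) w : ℝ) : ℂ) = ((2 * π / Real.cosh (2 * π * w) : ℝ) : ℂ) := by
    have i := fT_complex (1/4) w hw
    have hc := cot_add w hw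
    rw [show 2 * π / Real.cosh (2 * π * w) = π * (2 / Real.cosh (2 * π * w)) by ring, Complex.ofReal_mul, ← hc, ← i]
    push_cast
    ring
  rw [hval] at hS
  have hR := (Complex.continuous_re.tendsto _).comp hS
  simp only [Function.comp_def, Complex.ofReal_re] at hR
  have := hR.sub ((fT_tendsto w).div_const 2)
  simpa using this

lemma subst : ∫ x in Set.Ioi (1:ℝ), Real.log (Real.log x) / (1 + x ^ 2) =
    1/2 * ∫ w in Set.Ioi (0:ℝ), Real.log (2 * π * w) * (2 * π / Real.cosh (2 * π * w)) := by
  have himg : (fun w : ℝ => Real.exp (2 * π * w)) '' Set.Ioi 0 = Set.Ioi 1 := by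
    ext x
    simp only [Set.mem_image, Set.mem_Ioi]
    constructor
    · rintro ⟨w, hw, rfl⟩
      exact Real.one_lt_exp_iff.2 (by positivity)
    · intro hx
      have := Real.log_pos hx
      refine ⟨Real.log x / (2 * π), by positivity, ?_⟩
      rw [mul_div_cancel₀ _ (by positivity), Real.exp_log (by linarith)]
  have h := integral_image_eq_integral_abs_deriv_smul (s := Set.Ioi (0:ℝ)) (f := fun w : ℝ => Real.exp (2 * π * w))
    (f' := fun w => Real.exp (2 * π * w) * (2 * π)) measurableSet_Ioi
    (fun w _ => by
      have := ((hasDerivAt_id w).const_mul (2 * π)).exp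
      simpa using this.hasDerivWithinAt)
    (fun x _ y _ hxy => by
      have := Real.exp_injective hxy
      exact mul_left_cancel₀ (by positivity) this)
    (fun x => Real.log (Real.log x) / (1 + x ^ 2))
  rw [himg] at h
  rw [h, ← integral_const_mul]
  refine setIntegral_congr_fun measurableSet_Ioi fun w hw => ?_
  simp only [Real.log_exp, smul_eq_mul]
  rw [abs_of_pos (by positivity), Real.cosh_eq, Real.exp_neg]
  have := Real.exp_pos (2 * π * w)
  field_simp
  ring

open Filter Topology in
theorem stmt2 :
    ∫ x in Set.Ioi (1:ℝ), Real.log (Real.log x) / (1 + x ^ 2) =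
      (π / 2) * Real.log (Real.sqrt (2 * π) * Real.Gamma (3/4) / Real.Gamma (1/4)) := by
  rw [subst]
  have hpi : 0 < 2 * π := by positivity
  have hi : ∀ c : ℝ, 0 < c → IntegrableOn (fun w : ℝ => Real.log (2 * π * w) * fT c w) (Set.Ioi 0) :=
    fun c hc => int_log hpi hc
  have hI : ∀ c : ℝ, 0 < c → ∫ w in Set.Ioi (0:ℝ), Real.log (2 * π * w) * fT c w = π * Real.log (2 * π * c) :=
    fun c hc => integral_logT hpi hc
  have hval : ∀ N : ℕ, ∫ w in Set.Ioi (0:ℝ), Real.log (2 * π * w) * TT N w =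
      ∑ k ∈ Finset.range N, (π * Real.log (2 * π * (k + 1/4)) - π * Real.log (2 * π * (k + 3/4)))
        + π * Real.log (2 * π * (N + 1/4)) / 2 := by
    intro N
    have e : ∀ w, Real.log (2 * π * w) * TT N w =
        ∑ k ∈ Finset.range N, (Real.log (2 * π * w) * fT (k + 1/4) w - Real.log (2 * π * w) * fT (k + 3/4) w)
        + Real.log (2 * π * w) * fT (N + 1/4) w / 2 := by
      intro w
      simp only [TT, mul_add, Finset.mul_sum, mul_sub, mul_div_assoc]
    simp_rw [e]
    rw [integral_add, integral_finsetSum, integral_div, hI _ (by positivity)]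
    · congr 1
      refine Finset.sum_congr rfl fun k _ => ?_
      rw [integral_sub (hi _ (by positivity)) (hi _ (by positivity)), hI _ (by positivity), hI _ (by positivity)]
    · exact fun k _ => (hi _ (by positivity)).sub (hi _ (by positivity))
    · exact integrable_finsetSum _ fun k _ => (hi _ (by positivity)).sub (hi _ (by positivity))
    · exact (hi _ (by positivity)).div_const 2
  have hlim : Tendsto (fun N : ℕ => ∫ w in Set.Ioi (0:ℝ), Real.log (2 * π * w) * TT N w) atTop
      (𝓝 (∫ w in Set.Ioi (0:ℝ), Real.log (2 * π * w) * (2 * π / Real.cosh (2 * π * w)))) := by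
    refine tendsto_integral_of_dominated_convergence
      (fun w => ‖Real.log (2 * π * w) * (fT (1/4) w)‖ * 2) ?_ ((hi _ (by norm_num)).norm.mul_const 2) ?_ ?_
    · intro N
      have : Measurable (fun w => Real.log (2 * π * w) * TT N w) := by
        unfold TT fT; fun_prop
      exact this.aestronglyMeasurable
    · intro N
      refine ae_restrict_of_forall_mem measurableSet_Ioi fun w hw => ?_
      rw [norm_mul, norm_mul, mul_assoc ‖_‖]
      refine mul_le_mul_of_nonneg_left ?_ (norm_nonneg _)
      have := TT_bound N w hw
      rw [Real.norm_eq_abs]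
      refine this.trans (le_of_eq ?_)
      unfold fT
      rw [Real.norm_of_nonneg (by positivity)]
      ring
    · refine ae_restrict_of_forall_mem measurableSet_Ioi fun w hw => ?_
      exact (TT_tendsto w hw).const_mul _
  simp_rw [hval] at hlim
  have := tendsto_nhds_unique ((tendsto_add_atTop_iff_nat 1).2 hlim) gamma_lim
  rw [this]
  ring
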